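/- arXiv:2107.03410 — 2 statements merged into one kernel-verified Lean document; each statement's English description precedes it below -/
import Mathlib

section
/- Let d ≥ 1, let O be a d×d real orthogonal matrix, and let b* ∈ {0,1}^d. Then the number of bit strings x ∈ {0,1}^d satisfying ‖O(b* − x)‖₁ ≤ d/4 is at most 2^d·exp(−(d/2)·(1/(2√2) − 1/4)²). -/
open scoped Classical BigOperators

/-- The `ℓ₁`-norm of a vector in `ℝ^d`. -/
noncomputable def l1Norm {d : ℕ} (v : Fin d → ℝ) : ℝ := ∑ j, |v j|

/-- A real square matrix is orthogonal if `OᵀO = OOᵀ = I`. -/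
def IsOrthogonalMat {d : ℕ} (O : Matrix (Fin d) (Fin d) ℝ) : Prop :=
  O.transpose * O = 1 ∧ O * O.transpose = 1

/-- Identification of a bit string in `{0,1}^d` with a real vector. -/
def bitVec {d : ℕ} (x : Fin d → Bool) : Fin d → ℝ := fun j => if x j then 1 else 0

open Finset

/-- The sign `±1` attached to a bit. -/
def bitSign (b : Bool) : ℝ := if b then 1 else -1

lemma bitSign_not (b : Bool) : bitSign (!b) = -bitSign b := by
  cases b <;> simp [bitSign]

/-- The bit string obtained from `x` by flipping its `i`-th bit. -/
def flipBit {d : ℕ} (x : Fin d → Bool) (i : Fin d) : Fin d → Bool :=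
  Function.update x i (!x i)

lemma expect_cube_succ {d : ℕ} (F : (Fin (d + 1) → Bool) → ℝ) :
    𝔼 x, F x = ((𝔼 x, F (Fin.cons true x)) + 𝔼 x, F (Fin.cons false x)) / 2 := by
  have h : ∑ x, F x = ∑ x, F (Fin.cons true x) + ∑ x, F (Fin.cons false x) := by
    rw [← (Fin.consEquiv (fun _ : Fin (d + 1) => Bool)).sum_comp, Fintype.sum_prod_type,
      Fintype.sum_bool]
    rfl
  simp only [Fintype.expect_eq_sum_div_card, h, Fintype.card_fun, Fintype.card_bool,
    Fintype.card_fin]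
  push_cast
  rw [pow_succ]
  field_simp

lemma expect_cube_not {d : ℕ} (F : (Fin d → Bool) → ℝ) :
    𝔼 x : Fin d → Bool, F (fun i => !x i) = 𝔼 x, F x :=
  Fintype.expect_equiv (Equiv.arrowCongr (Equiv.refl _) Equiv.boolNot) _ _ (fun _ => rfl)

lemma flipBit_cons_zero {d : ℕ} (b : Bool) (x : Fin d → Bool) :
    flipBit (Fin.cons b x : Fin (d + 1) → Bool) 0 = Fin.cons (!b) x := by
  simp [flipBit, Fin.update_cons_zero]

lemma flipBit_cons_succ {d : ℕ} (b : Bool) (x : Fin d → Bool) (i : Fin d) :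
    flipBit (Fin.cons b x : Fin (d + 1) → Bool) i.succ = Fin.cons b (flipBit x i) := by
  simp [flipBit, Fin.cons_update]

/-- Bessel's inequality on the cube for the Walsh functions of degree at most one. -/
lemma bessel_degree_one {d : ℕ} (h : (Fin d → Bool) → ℝ) :
    (𝔼 x, h x) ^ 2 + ∑ i, (𝔼 x, h x * bitSign (x i)) ^ 2 ≤ 𝔼 x, h x ^ 2 := by
  induction d with
  | zero => simp
  | succ d ih =>
    have h1 := ih (fun x => h (Fin.cons true x))
    have h0 := ih (fun x => h (Fin.cons false x))
    rw [Fin.sum_univ_succ]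
    have e1 : bitSign true = 1 := rfl
    have e0 : bitSign false = -1 := rfl
    simp only [expect_cube_succ, Fin.cons_zero, Fin.cons_succ, e1, e0, mul_one, mul_neg,
      expect_neg_distrib]
    have hs : ∑ i : Fin d, (((𝔼 x, h (Fin.cons true x) * bitSign (x i)) +
        𝔼 x, h (Fin.cons false x) * bitSign (x i)) / 2) ^ 2 ≤
        (∑ i : Fin d, (𝔼 x, h (Fin.cons true x) * bitSign (x i)) ^ 2 +
        ∑ i : Fin d, (𝔼 x, h (Fin.cons false x) * bitSign (x i)) ^ 2) / 2 := by
      rw [← sum_add_distrib, sum_div]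
      refine sum_le_sum fun i _ => ?_
      generalize (𝔼 x, h (Fin.cons true x) * bitSign (x i)) = u
      generalize (𝔼 x, h (Fin.cons false x) * bitSign (x i)) = v
      nlinarith [sq_nonneg (u - v)]
    linarith

/-- The Poincaré inequality on the cube with spectral gap two, up to the degree-one weight. -/
lemma poincare_degree_two {d : ℕ} (f : (Fin d → Bool) → ℝ) :
    2 * ((𝔼 x, f x ^ 2) - (𝔼 x, f x) ^ 2) - ∑ i, (𝔼 x, f x * bitSign (x i)) ^ 2 ≤
      (∑ i, 𝔼 x, (f x - f (flipBit x i)) ^ 2) / 4 := by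
  induction d with
  | zero => simp
  | succ d ih =>
    have h1 := ih (fun x => f (Fin.cons true x))
    have h0 := ih (fun x => f (Fin.cons false x))
    have hB := bessel_degree_one (fun x => f (Fin.cons true x) - f (Fin.cons false x))
    simp only [sub_mul, expect_sub_distrib] at hB
    rw [Fin.sum_univ_succ, Fin.sum_univ_succ]
    simp only [expect_cube_succ, Fin.cons_zero, Fin.cons_succ, flipBit_cons_zero,
      flipBit_cons_succ, Bool.not_true, Bool.not_false, ← sum_div, sum_add_distrib]
    have e1 : bitSign true = 1 := rfl
    have e0 : bitSign false = -1 := rfl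
    simp only [e1, e0, mul_one, mul_neg, expect_neg_distrib]
    have hsym : 𝔼 x, (f (Fin.cons false x) - f (Fin.cons true x)) ^ 2 =
        𝔼 x, (f (Fin.cons true x) - f (Fin.cons false x)) ^ 2 :=
      expect_congr rfl fun x _ => by ring
    rw [hsym]
    have hs : ∑ i : Fin d, (((𝔼 x, f (Fin.cons true x) * bitSign (x i)) +
        𝔼 x, f (Fin.cons false x) * bitSign (x i)) / 2) ^ 2 =
        (∑ i : Fin d, (𝔼 x, f (Fin.cons true x) * bitSign (x i)) ^ 2 +
        ∑ i : Fin d, (𝔼 x, f (Fin.cons false x) * bitSign (x i)) ^ 2) / 2 -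
        (∑ i : Fin d, ((𝔼 x, f (Fin.cons true x) * bitSign (x i)) -
        𝔼 x, f (Fin.cons false x) * bitSign (x i)) ^ 2) / 4 := by
      rw [← sum_add_distrib, sum_div, sum_div, ← sum_sub_distrib]
      exact sum_congr rfl fun i _ => by ring
    rw [hs]
    linarith

lemma expect_rademacher_sum {d : ℕ} (a : Fin d → ℝ) :
    𝔼 x : Fin d → Bool, ∑ j, a j * bitSign (x j) = 0 := by
  induction d with
  | zero => simp
  | succ d ih =>
    have h := ih (fun j => a j.succ)
    simp only [expect_cube_succ, Fin.sum_univ_succ, Fin.cons_zero, Fin.cons_succ,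
      expect_add_distrib, h, Fintype.expect_const]
    simp [bitSign]

lemma expect_rademacher_sum_sq {d : ℕ} (a : Fin d → ℝ) :
    𝔼 x : Fin d → Bool, (∑ j, a j * bitSign (x j)) ^ 2 = ∑ j, a j ^ 2 := by
  induction d with
  | zero => simp
  | succ d ih =>
    have h := ih (fun j => a j.succ)
    have h' := expect_rademacher_sum (fun j => a j.succ)
    simp only [expect_cube_succ, Fin.sum_univ_succ, Fin.cons_zero, Fin.cons_succ, add_sq,
      expect_add_distrib, ← mul_expect, h, h', Fintype.expect_const]
    simp [bitSign]

/-- Khintchine's inequality for the first moment, with the optimal constant `1/√2`. -/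
lemma khintchine_sq {d : ℕ} (a : Fin d → ℝ) :
    ∑ j, a j ^ 2 ≤ 2 * (𝔼 x : Fin d → Bool, |∑ j, a j * bitSign (x j)|) ^ 2 := by
  have hP := poincare_degree_two (fun x : Fin d → Bool => |∑ j, a j * bitSign (x j)|)
  simp only [sq_abs, expect_rademacher_sum_sq] at hP
  have hodd : ∀ i, 𝔼 x : Fin d → Bool, |∑ j, a j * bitSign (x j)| * bitSign (x i) = 0 := by
    intro i
    have h := expect_cube_not
      (fun x : Fin d → Bool => |∑ j, a j * bitSign (x j)| * bitSign (x i))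
    simp only [bitSign_not, mul_neg, sum_neg_distrib, abs_neg, expect_neg_distrib] at h
    linarith
  simp only [hodd] at hP
  have hD : ∀ i, 𝔼 x : Fin d → Bool, (|∑ j, a j * bitSign (x j)| -
      |∑ j, a j * bitSign (flipBit x i j)|) ^ 2 ≤ 4 * a i ^ 2 := by
    intro i
    refine expect_le univ_nonempty fun x _ => ?_
    have hdiff : ∑ j, a j * bitSign (x j) - ∑ j, a j * bitSign (flipBit x i j) =
        2 * (a i * bitSign (x i)) := by
      rw [← sum_sub_distrib, sum_eq_single i]
      · simp only [flipBit, Function.update_self, bitSign_not]; ring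
      · intro j _ hj
        simp [flipBit, Function.update_of_ne hj]
      · simp
    have hsq : bitSign (x i) ^ 2 = 1 := by cases x i <;> simp [bitSign]
    calc _ ≤ (∑ j, a j * bitSign (x j) - ∑ j, a j * bitSign (flipBit x i j)) ^ 2 :=
          sq_le_sq.2 (abs_abs_sub_abs_le _ _)
      _ = 4 * a i ^ 2 := by rw [hdiff, mul_pow, mul_pow, hsq]; ring
  have hsum := sum_le_sum fun i (_ : i ∈ univ) => hD i
  rw [← mul_sum] at hsum
  simp only [ne_eq, OfNat.ofNat_ne_zero, not_false_eq_true, zero_pow, sum_const_zero] at hP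
  linarith

lemma expect_abs_affine_ge {d : ℕ} (c : ℝ) (a : Fin d → ℝ) (ha : ∑ j, a j ^ 2 = 1) :
    1 / (2 * √2) ≤ 𝔼 x : Fin d → Bool, |c - (∑ j, a j * bitSign (x j)) / 2| := by
  have hK := khintchine_sq a
  set K := 𝔼 x : Fin d → Bool, |∑ j, a j * bitSign (x j)| with hKdef
  have hK0 : 0 ≤ K := expect_nonneg fun x _ => abs_nonneg _
  have hK1 : 1 / √2 ≤ K := by
    refine (sq_le_sq₀ (by positivity) hK0).1 ?_
    rw [div_pow, Real.sq_sqrt (by norm_num)]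
    linarith
  have h := expect_cube_not (fun x : Fin d → Bool => |c - (∑ j, a j * bitSign (x j)) / 2|)
  simp only [bitSign_not, mul_neg, sum_neg_distrib] at h
  have hle : K ≤ (𝔼 x : Fin d → Bool, |c - (∑ j, a j * bitSign (x j)) / 2|) +
      𝔼 x : Fin d → Bool, |c - (-∑ j, a j * bitSign (x j)) / 2| := by
    rw [← expect_add_distrib]
    refine expect_le_expect fun x _ => ?_
    refine le_trans (le_of_eq ?_) (abs_sub (c - (-∑ j, a j * bitSign (x j)) / 2)
      (c - (∑ j, a j * bitSign (x j)) / 2) |>.trans (le_of_eq (add_comm _ _)))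
    congr 1
    ring
  have e : 1 / (2 * √2) = 1 / √2 / 2 := by field_simp
  rw [e]
  linarith

/-- The infimal convolution of `f` with half the squared Euclidean norm. -/
noncomputable def quadInfConv {d : ℕ} (f : (Fin d → ℝ) → ℝ) (x : Fin d → ℝ) : ℝ :=
  ⨅ y, (f y + (∑ i, (x i - y i) ^ 2) / 2)

lemma quadInfConv_le {d : ℕ} {f : (Fin d → ℝ) → ℝ} (hf : ∀ y, 0 ≤ f y) (x y : Fin d → ℝ) :
    quadInfConv f x ≤ f y + (∑ i, (x i - y i) ^ 2) / 2 :=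
  ciInf_le ⟨0, by
    rintro _ ⟨z, rfl⟩
    exact add_nonneg (hf z) (div_nonneg (sum_nonneg fun i _ => sq_nonneg _) zero_le_two)⟩ y

lemma quadInfConv_cons_le {d : ℕ} {f : (Fin (d + 1) → ℝ) → ℝ} (hf : ∀ y, 0 ≤ f y)
    (hconv : ConvexOn ℝ Set.univ f) {s s' : ℝ} (hs : (s - s') ^ 2 = 1) {t : ℝ} (ht0 : 0 ≤ t)
    (ht1 : t ≤ 1) (x : Fin d → ℝ) :
    quadInfConv f (Fin.cons s x) ≤ (1 - t) * quadInfConv (fun y => f (Fin.cons s y)) x +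
      t * quadInfConv (fun y => f (Fin.cons s' y)) x + t ^ 2 / 2 := by
  refine le_of_forall_pos_le_add fun ε hε => ?_
  obtain ⟨y, hy⟩ := exists_lt_of_ciInf_lt
    (lt_add_of_pos_right (quadInfConv (fun y => f (Fin.cons s y)) x) hε)
  obtain ⟨z, hz⟩ := exists_lt_of_ciInf_lt
    (lt_add_of_pos_right (quadInfConv (fun y => f (Fin.cons s' y)) x) hε)
  have h := quadInfConv_le hf (Fin.cons s x)
    ((1 - t) • (Fin.cons s y : Fin (d + 1) → ℝ) + t • (Fin.cons s' z : Fin (d + 1) → ℝ))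
  have hc := hconv.2 (Set.mem_univ (Fin.cons s y : Fin (d + 1) → ℝ))
    (Set.mem_univ (Fin.cons s' z : Fin (d + 1) → ℝ)) (sub_nonneg.2 ht1) ht0 (by ring)
  simp only [smul_eq_mul] at hc
  rw [Fin.sum_univ_succ] at h
  simp only [Pi.add_apply, Pi.smul_apply, smul_eq_mul, Fin.cons_zero, Fin.cons_succ] at h
  have h0 : (s - ((1 - t) * s + t * s')) ^ 2 = t ^ 2 := by
    linear_combination t ^ 2 * hs
  have hq : ∑ i, (x i - ((1 - t) * y i + t * z i)) ^ 2 ≤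
      (1 - t) * ∑ i, (x i - y i) ^ 2 + t * ∑ i, (x i - z i) ^ 2 := by
    rw [mul_sum, mul_sum, ← sum_add_distrib]
    refine sum_le_sum fun i _ => ?_
    nlinarith [mul_nonneg (mul_nonneg ht0 (sub_nonneg.2 ht1)) (sq_nonneg (y i - z i))]
  have h1 := mul_le_mul_of_nonneg_left hy.le (sub_nonneg.2 ht1)
  have h2 := mul_le_mul_of_nonneg_left hz.le ht0
  rw [h0] at h
  linarith

lemma exp_neg_avg_le_of_le {a b u v : ℝ} (hab : a ≤ b) (hu : u ≤ a)
    (hv : ∀ t : ℝ, 0 ≤ t → t ≤ 1 → v ≤ (1 - t) * b + t * a + t ^ 2 / 2) :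
    (Real.exp (-a) + Real.exp (-b)) / 2 ≤ Real.exp (-((u + v) / 2)) := by
  rcases le_total (b - a) 1 with hD | hD
  · have h := hv (b - a) (sub_nonneg.2 hab) hD
    have hc := Real.cosh_le_exp_half_sq ((b - a) / 2)
    have e : (Real.exp (-a) + Real.exp (-b)) / 2 =
        Real.exp (-((a + b) / 2)) * Real.cosh ((b - a) / 2) := by
      rw [Real.cosh_eq, mul_div_assoc', mul_add, ← Real.exp_add, ← Real.exp_add]
      ring_nf
    rw [e]
    refine (mul_le_mul_of_nonneg_left hc (Real.exp_pos _).le).trans ?_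
    rw [← Real.exp_add]
    refine Real.exp_le_exp.2 ?_
    nlinarith [sq_nonneg (b - a)]
  · have h := hv 1 zero_le_one le_rfl
    have e1 : Real.exp (-1) ≤ 1 / 2 := by
      rw [Real.exp_neg, one_div]
      exact inv_anti₀ two_pos (by linarith [Real.add_one_le_exp (1 : ℝ)])
    have e2 : (3 / 4 : ℝ) ≤ Real.exp (-(1 / 4)) := by
      linarith [Real.add_one_le_exp (-(1 / 4) : ℝ)]
    have e3 : Real.exp (-b) ≤ Real.exp (-a) * Real.exp (-1) := by
      rw [← Real.exp_add]
      exact Real.exp_le_exp.2 (by linarith)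
    have e4 : Real.exp (-a) * Real.exp (-(1 / 4)) ≤ Real.exp (-((u + v) / 2)) := by
      rw [← Real.exp_add]
      exact Real.exp_le_exp.2 (by linarith)
    nlinarith [Real.exp_pos (-a)]

lemma exp_neg_avg_le {a b u v : ℝ}
    (hu : ∀ t : ℝ, 0 ≤ t → t ≤ 1 → u ≤ (1 - t) * a + t * b + t ^ 2 / 2)
    (hv : ∀ t : ℝ, 0 ≤ t → t ≤ 1 → v ≤ (1 - t) * b + t * a + t ^ 2 / 2) :
    (Real.exp (-a) + Real.exp (-b)) / 2 ≤ Real.exp (-((u + v) / 2)) := by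
  rcases le_total a b with hab | hab
  · exact exp_neg_avg_le_of_le hab (by simpa using hu 0 le_rfl zero_le_one) hv
  · rw [add_comm, add_comm u]
    exact exp_neg_avg_le_of_le hab (by simpa using hv 0 le_rfl zero_le_one) hu

lemma bitVec_cons {d : ℕ} (b : Bool) (x : Fin d → Bool) :
    bitVec (Fin.cons b x : Fin (d + 1) → Bool) = Fin.cons (if b then 1 else 0) (bitVec x) := by
  funext j
  refine Fin.cases ?_ (fun i => ?_) j <;> simp [bitVec]

lemma ConvexOn.comp_cons {d : ℕ} {f : (Fin (d + 1) → ℝ) → ℝ} (hconv : ConvexOn ℝ Set.univ f)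
    (s : ℝ) : ConvexOn ℝ Set.univ fun y : Fin d → ℝ => f (Fin.cons s y) := by
  refine ⟨convex_univ, fun y _ z _ a b ha hb hab => ?_⟩
  have h := hconv.2 (Set.mem_univ (Fin.cons s y : Fin (d + 1) → ℝ))
    (Set.mem_univ (Fin.cons s z : Fin (d + 1) → ℝ)) ha hb hab
  have e : a • (Fin.cons s y : Fin (d + 1) → ℝ) + b • (Fin.cons s z : Fin (d + 1) → ℝ) =
      Fin.cons s (a • y + b • z) := by
    funext j
    refine Fin.cases ?_ (fun i => ?_) j
    · simp [← add_mul, hab]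
    · simp
  rwa [e] at h

/-- Dual form of the weak transport inequality for convex functions on the cube. -/
lemma expect_exp_neg_le {d : ℕ} {f : (Fin d → ℝ) → ℝ} (hf : ∀ y, 0 ≤ f y)
    (hconv : ConvexOn ℝ Set.univ f) :
    𝔼 x, Real.exp (-f (bitVec x)) ≤ Real.exp (-𝔼 x, quadInfConv f (bitVec x)) := by
  induction d with
  | zero =>
    simp only [univ_unique, expect_singleton]
    refine Real.exp_le_exp.2 (neg_le_neg ?_)
    exact (quadInfConv_le hf (bitVec default) (bitVec default)).trans
      (by
        rw [Fin.sum_univ_zero, zero_div, add_zero]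
        exact (congrArg f (Subsingleton.elim _ _)).le)
  | succ d ih =>
    have h1 := ih (fun y => hf (Fin.cons 1 y)) (hconv.comp_cons 1)
    have h0 := ih (fun y => hf (Fin.cons 0 y)) (hconv.comp_cons 0)
    simp only [expect_cube_succ, bitVec_cons, if_true, Bool.false_eq_true, if_false]
    refine le_trans (by linarith) (exp_neg_avg_le
      (a := 𝔼 x : Fin d → Bool, quadInfConv (fun y => f (Fin.cons 1 y)) (bitVec x))
      (b := 𝔼 x : Fin d → Bool, quadInfConv (fun y => f (Fin.cons 0 y)) (bitVec x)) ?_ ?_)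
    all_goals
      intro t ht0 ht1
      rw [mul_expect, mul_expect, ← expect_add_distrib,
        ← Fintype.expect_const (ι := Fin d → Bool) (t ^ 2 / 2), ← expect_add_distrib]
      exact expect_le_expect fun x _ =>
        quadInfConv_cons_le hf hconv (by norm_num) ht0 ht1 (bitVec x)

lemma sum_mulVec_sq {d : ℕ} {O : Matrix (Fin d) (Fin d) ℝ} (hO : IsOrthogonalMat O)
    (v : Fin d → ℝ) : ∑ i, O.mulVec v i ^ 2 = ∑ i, v i ^ 2 := by
  have h : O.mulVec v ⬝ᵥ O.mulVec v = v ⬝ᵥ v := by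
    rw [Matrix.dotProduct_mulVec, ← Matrix.mulVec_transpose, Matrix.mulVec_mulVec, hO.1,
      Matrix.one_mulVec]
  simpa only [dotProduct, ← pow_two] using h

lemma sum_row_sq {d : ℕ} {O : Matrix (Fin d) (Fin d) ℝ} (hO : IsOrthogonalMat O) (i : Fin d) :
    ∑ j, O i j ^ 2 = 1 := by
  have h := congrFun (congrFun hO.2 i) i
  simpa only [Matrix.mul_apply, Matrix.transpose_apply, Matrix.one_apply_eq, ← pow_two] using h

lemma l1Norm_nonneg {d : ℕ} (v : Fin d → ℝ) : 0 ≤ l1Norm v :=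
  sum_nonneg fun _ _ => abs_nonneg _

lemma l1Norm_add_le {d : ℕ} (v w : Fin d → ℝ) : l1Norm (v + w) ≤ l1Norm v + l1Norm w := by
  simp only [l1Norm, ← sum_add_distrib]
  exact sum_le_sum fun i _ => abs_add_le _ _

lemma l1Norm_smul {d : ℕ} (c : ℝ) (v : Fin d → ℝ) : l1Norm (c • v) = |c| * l1Norm v := by
  simp [l1Norm, abs_mul, mul_sum]

lemma convexOn_l1Norm_mulVec_sub {d : ℕ} (O : Matrix (Fin d) (Fin d) ℝ) (w : Fin d → ℝ) :
    ConvexOn ℝ Set.univ fun y => l1Norm (O.mulVec (w - y)) := by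
  refine ⟨convex_univ, fun y _ z _ a b ha hb hab => ?_⟩
  have e : w - (a • y + b • z) = a • (w - y) + b • (w - z) := by
    have : w = (a + b) • w := by rw [hab, one_smul]
    nth_rewrite 1 [this]
    module
  simp only [e, Matrix.mulVec_add, Matrix.mulVec_smul, smul_eq_mul]
  refine (l1Norm_add_le _ _).trans (le_of_eq ?_)
  rw [l1Norm_smul, l1Norm_smul, abs_of_nonneg ha, abs_of_nonneg hb]

lemma mul_l1Norm_mulVec_le {d : ℕ} {O : Matrix (Fin d) (Fin d) ℝ} (hO : IsOrthogonalMat O)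
    (r : ℝ) (v : Fin d → ℝ) :
    r * l1Norm (O.mulVec v) ≤ (∑ i, v i ^ 2) / 2 + d * r ^ 2 / 2 := by
  have h : r * l1Norm (O.mulVec v) ≤ ∑ i, (O.mulVec v i ^ 2 / 2 + r ^ 2 / 2) := by
    rw [l1Norm, mul_sum]
    refine sum_le_sum fun i _ => ?_
    nlinarith [sq_nonneg (|O.mulVec v i| - r), sq_abs (O.mulVec v i)]
  rw [sum_add_distrib, ← sum_div, sum_mulVec_sq hO] at h
  simp only [sum_const, card_univ, Fintype.card_fin, nsmul_eq_mul] at h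
  linarith

lemma quadInfConv_l1Norm_ge {d : ℕ} {O : Matrix (Fin d) (Fin d) ℝ} (hO : IsOrthogonalMat O)
    {r : ℝ} (hr : 0 ≤ r) (w x : Fin d → ℝ) :
    r * l1Norm (O.mulVec (w - x)) - d * r ^ 2 / 2 ≤
      quadInfConv (fun y => r * l1Norm (O.mulVec (w - y))) x := by
  refine le_ciInf fun y => ?_
  have h := mul_l1Norm_mulVec_le hO r (y - x)
  have htri := l1Norm_add_le (O.mulVec (w - y)) (O.mulVec (y - x))
  rw [← Matrix.mulVec_add, sub_add_sub_cancel] at htri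
  have hsq : ∑ i, (y - x) i ^ 2 = ∑ i, (x i - y i) ^ 2 :=
    sum_congr rfl fun i _ => by rw [Pi.sub_apply]; ring
  rw [hsq] at h
  have := mul_le_mul_of_nonneg_left htri hr
  linarith

lemma expect_l1Norm_ge {d : ℕ} {O : Matrix (Fin d) (Fin d) ℝ} (hO : IsOrthogonalMat O)
    (w : Fin d → ℝ) :
    d * (1 / (2 * √2)) ≤ 𝔼 x, l1Norm (O.mulVec (w - bitVec x)) := by
  simp only [l1Norm]
  rw [expect_sum_comm]
  have h : ∀ i ∈ univ, 1 / (2 * √2) ≤ 𝔼 x, |O.mulVec (w - bitVec x) i| := by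
    intro i _
    refine (expect_abs_affine_ge (∑ j, O i j * (w j - 1 / 2)) (O i) (sum_row_sq hO i)).trans
      (le_of_eq (expect_congr rfl fun x _ => ?_))
    rw [sum_div, ← sum_sub_distrib]
    refine congrArg abs (sum_congr rfl fun j _ => ?_)
    cases hx : x j <;> simp only [bitSign, bitVec, Pi.sub_apply, hx, if_true,
      Bool.false_eq_true, if_false] <;> ring
  simpa using card_nsmul_le_sum _ _ _ h

/-- the number of bit strings `x ∈ {0,1}^d` with `‖O(b* − x)‖₁ ≤ d/4`
is at most `2^d·exp(−(d/2)·(1/(2√2) − 1/4)²)`. -/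
theorem high_overlap_ball_count (d : ℕ) (hd : 1 ≤ d)
    (O : Matrix (Fin d) (Fin d) ℝ) (hO : IsOrthogonalMat O)
    (bstar : Fin d → Bool) :
    (((Finset.univ : Finset (Fin d → Bool)).filter fun x =>
        l1Norm (O.mulVec (bitVec bstar - bitVec x)) ≤ (d : ℝ) / 4).card : ℝ)
      ≤ 2 ^ d * Real.exp (-((d : ℝ) / 2) * (1 / (2 * Real.sqrt 2) - 1 / 4) ^ 2) := by
  set δ : ℝ := 1 / (2 * Real.sqrt 2) - 1 / 4 with hδdef
  have hδ : 0 ≤ δ := by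
    have h2 : Real.sqrt 2 ≤ 2 := by
      rw [Real.sqrt_le_left (by norm_num)]
      norm_num
    have : 1 / 4 ≤ 1 / (2 * Real.sqrt 2) :=
      one_div_le_one_div_of_le (by positivity) (by linarith)
    linarith
  have hlap := expect_exp_neg_le
    (f := fun y => δ * l1Norm (O.mulVec (bitVec bstar - y)))
    (fun y => mul_nonneg hδ (l1Norm_nonneg _)) ((convexOn_l1Norm_mulVec_sub O _).smul hδ)
  have hQ : δ * (d * (1 / (2 * Real.sqrt 2))) - d * δ ^ 2 / 2 ≤
      𝔼 x, quadInfConv (fun y => δ * l1Norm (O.mulVec (bitVec bstar - y))) (bitVec x) := by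
    refine le_trans ?_ (expect_le_expect fun x _ =>
      quadInfConv_l1Norm_ge hO hδ (bitVec bstar) (bitVec x))
    rw [expect_sub_distrib, ← mul_expect, Fintype.expect_const]
    exact sub_le_sub_right (mul_le_mul_of_nonneg_left (expect_l1Norm_ge hO _) hδ) _
  rw [Fintype.expect_eq_sum_div_card, Fintype.card_fun, Fintype.card_bool, Fintype.card_fin,
    Nat.cast_pow, Nat.cast_two, div_le_iff₀ (by positivity)] at hlap
  have hmarkov : (((Finset.univ : Finset (Fin d → Bool)).filter fun x =>
        l1Norm (O.mulVec (bitVec bstar - bitVec x)) ≤ (d : ℝ) / 4).card : ℝ) *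
      Real.exp (-(δ * (d / 4))) ≤
      ∑ x, Real.exp (-(δ * l1Norm (O.mulVec (bitVec bstar - bitVec x)))) := by
    rw [← nsmul_eq_mul]
    refine (card_nsmul_le_sum _ _ _ fun x hx => ?_).trans
      (sum_le_sum_of_subset_of_nonneg (filter_subset _ _) fun x _ _ => (Real.exp_pos _).le)
    exact Real.exp_le_exp.2 (neg_le_neg (mul_le_mul_of_nonneg_left (mem_filter.1 hx).2 hδ))
  refine le_of_mul_le_mul_right (hmarkov.trans (hlap.trans ?_)) (Real.exp_pos (-(δ * (d / 4))))
  rw [mul_comm, mul_assoc, ← Real.exp_add]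
  refine mul_le_mul_of_nonneg_left (Real.exp_le_exp.2 ?_) (by positivity)
  have e : 1 / (2 * Real.sqrt 2) = δ + 1 / 4 := by rw [hδdef]; ring
  rw [e] at hQ
  linarith
end

section
/- Let d ≥ 1 and let O be a d×d real orthogonal matrix. Then the number of x ∈ {0,1}^d with ‖Ox‖₁ ≤ d/4 is at most 2^d · exp(−(d/2)·(1/(2√2) − 1/4)²). Equivalently, if x is drawn uniformly from {0,1}^d, then P[‖Ox‖₁ ≤ d/4] ≤ 2^{−(log₂e/2)·(1/(2√2) − 1/4)²·d}. -/
open scoped Classical BigOperators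

namespace RotatedCube

/-- The average of a function over the discrete cube. -/
noncomputable def cubeMean {n : ℕ} (h : (Fin n → Bool) → ℝ) : ℝ := (∑ x, h x) / 2 ^ n

/-- The `±1`-valued sign of a bit. -/
noncomputable def bitSign (b : Bool) : ℝ := if b then 1 else -1

/-- The vertex of the cube obtained by flipping the `i`-th bit. -/
def flipBit {n : ℕ} (i : Fin n) (x : Fin n → Bool) : Fin n → Bool :=
  Function.update x i (!x i)

/-- The Dirichlet energy of a function on the discrete cube. -/
noncomputable def cubeEnergy {n : ℕ} (h : (Fin n → Bool) → ℝ) : ℝ :=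
  ∑ i, cubeMean fun x => (h x - h (flipBit i x)) ^ 2

/-- The Rademacher sum with coefficients `a`. -/
noncomputable def signSum {n : ℕ} (a : Fin n → ℝ) (x : Fin n → Bool) : ℝ :=
  ∑ j, a j * bitSign (x j)

section Mean

variable {n : ℕ}

lemma cubeMean_succ (h : (Fin (n + 1) → Bool) → ℝ) :
    cubeMean h = (cubeMean (fun x => h (Fin.cons true x)) +
      cubeMean (fun x => h (Fin.cons false x))) / 2 := by
  unfold cubeMean
  rw [← (Fin.consEquiv fun _ : Fin (n + 1) => Bool).sum_comp, Fintype.sum_prod_type]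
  simp only [Fintype.sum_bool]
  rw [pow_succ]
  field_simp
  rfl

lemma cubeMean_add (f g : (Fin n → Bool) → ℝ) :
    cubeMean (fun x => f x + g x) = cubeMean f + cubeMean g := by
  simp only [cubeMean, Finset.sum_add_distrib, add_div]

lemma cubeMean_const_mul (c : ℝ) (f : (Fin n → Bool) → ℝ) :
    cubeMean (fun x => c * f x) = c * cubeMean f := by
  simp only [cubeMean, ← Finset.mul_sum, mul_div_assoc]

lemma cubeMean_neg (f : (Fin n → Bool) → ℝ) :
    cubeMean (fun x => -f x) = -cubeMean f := by
  simp only [cubeMean, Finset.sum_neg_distrib, neg_div]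

lemma cubeMean_sub (f g : (Fin n → Bool) → ℝ) :
    cubeMean (fun x => f x - g x) = cubeMean f - cubeMean g := by
  simp only [cubeMean, Finset.sum_sub_distrib, sub_div]

lemma cubeMean_sum {ι : Type*} (s : Finset ι) (f : ι → (Fin n → Bool) → ℝ) :
    cubeMean (fun x => ∑ i ∈ s, f i x) = ∑ i ∈ s, cubeMean (f i) := by
  simp only [cubeMean]
  rw [Finset.sum_comm, Finset.sum_div]

lemma cubeMean_const (c : ℝ) : cubeMean (fun _ : Fin n → Bool => c) = c := by
  simp [cubeMean]

lemma cubeMean_mono {f g : (Fin n → Bool) → ℝ} (h : ∀ x, f x ≤ g x) :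
    cubeMean f ≤ cubeMean g := by
  unfold cubeMean
  gcongr with x
  exact h x

lemma cubeMean_comp_of_involutive {φ : (Fin n → Bool) → Fin n → Bool}
    (hφ : Function.Involutive φ) (f : (Fin n → Bool) → ℝ) :
    cubeMean (fun x => f (φ x)) = cubeMean f := by
  unfold cubeMean
  congr 1
  exact Equiv.sum_comp hφ.toPerm f

end Mean

section Flip

variable {n : ℕ}

lemma bitSign_not (b : Bool) : bitSign (!b) = -bitSign b := by
  cases b <;> simp [bitSign]

lemma flipBit_involutive (i : Fin n) : Function.Involutive (flipBit i) := by
  intro x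
  simp [flipBit]

lemma flipBit_zero_cons (b : Bool) (x : Fin n → Bool) :
    flipBit 0 (Fin.cons b x : Fin (n + 1) → Bool) = Fin.cons (!b) x := by
  simp [flipBit]

lemma flipBit_succ_cons (i : Fin n) (b : Bool) (x : Fin n → Bool) :
    flipBit i.succ (Fin.cons b x : Fin (n + 1) → Bool) = Fin.cons b (flipBit i x) := by
  simp [flipBit, Fin.cons_update]

lemma not_involutive : Function.Involutive fun (x : Fin n → Bool) j => !x j := by
  intro x
  simp

lemma signSum_not (a : Fin n → ℝ) (x : Fin n → Bool) :
    signSum a (fun j => !x j) = -signSum a x := by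
  simp [signSum, bitSign_not]

lemma signSum_flipBit (a : Fin n → ℝ) (i : Fin n) (x : Fin n → Bool) :
    signSum a (flipBit i x) = signSum a x - 2 * (a i * bitSign (x i)) := by
  have h : ∀ j, a j * bitSign (flipBit i x j) =
      a j * bitSign (x j) - if j = i then 2 * (a i * bitSign (x i)) else 0 := by
    intro j
    by_cases hj : j = i
    · subst hj
      simp [flipBit, bitSign_not]
      ring
    · simp [flipBit, hj]
  simp [signSum, h, Finset.sum_sub_distrib]

end Flip

section Poincare

variable {n : ℕ}

lemma cubeEnergy_nonneg (h : (Fin n → Bool) → ℝ) : 0 ≤ cubeEnergy h :=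
  Finset.sum_nonneg fun _ _ => div_nonneg (Finset.sum_nonneg fun _ _ => sq_nonneg _) (by positivity)

lemma cubeEnergy_succ (h : (Fin (n + 1) → Bool) → ℝ) :
    cubeEnergy h =
      cubeMean (fun x => (h (Fin.cons true x) - h (Fin.cons false x)) ^ 2) +
      (cubeEnergy (fun x => h (Fin.cons true x)) +
        cubeEnergy (fun x => h (Fin.cons false x))) / 2 := by
  unfold cubeEnergy
  rw [Fin.sum_univ_succ]
  congr 1
  · rw [cubeMean_succ]
    simp only [flipBit_zero_cons, Bool.not_true, Bool.not_false]
    rw [show (fun x : Fin n → Bool => (h (Fin.cons false x) - h (Fin.cons true x)) ^ 2) =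
      fun x => (h (Fin.cons true x) - h (Fin.cons false x)) ^ 2 from funext fun x => by ring]
    ring
  · simp only [cubeMean_succ (n := n), flipBit_succ_cons]
    rw [← Finset.sum_div, Finset.sum_add_distrib]

lemma cubeEnergy_add_add_sub (u v : (Fin n → Bool) → ℝ) :
    cubeEnergy (fun x => u x + v x) + cubeEnergy (fun x => u x - v x) =
      2 * (cubeEnergy u + cubeEnergy v) := by
  unfold cubeEnergy
  rw [← Finset.sum_add_distrib, ← Finset.sum_add_distrib, Finset.mul_sum]
  refine Finset.sum_congr rfl fun i _ => ?_
  rw [← cubeMean_add, ← cubeMean_add, ← cubeMean_const_mul]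
  congr 1
  funext x
  ring

lemma cubeMean_sq_add_sq_sub (u v : (Fin n → Bool) → ℝ) :
    cubeMean (fun x => (u x + v x) ^ 2) + cubeMean (fun x => (u x - v x) ^ 2) =
      2 * (cubeMean (fun x => u x ^ 2) + cubeMean (fun x => v x ^ 2)) := by
  rw [← cubeMean_add, ← cubeMean_add, ← cubeMean_const_mul]
  congr 1
  funext x
  ring

/-- The Poincaré inequality on the discrete cube. -/
lemma cubeMean_sq_sub_sq_le_cubeEnergy (h : (Fin n → Bool) → ℝ) :
    cubeMean (fun x => h x ^ 2) - cubeMean h ^ 2 ≤ cubeEnergy h / 4 := by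
  induction n with
  | zero => simp [cubeMean, cubeEnergy]
  | succ n ih =>
    set u : (Fin n → Bool) → ℝ := fun x => h (Fin.cons true x)
    set v : (Fin n → Bool) → ℝ := fun x => h (Fin.cons false x)
    have hE := cubeEnergy_succ h
    have hM := cubeMean_succ h
    have hM2 := cubeMean_succ fun x => h x ^ 2
    have hE2 := cubeEnergy_add_add_sub u v
    have hS := cubeMean_sq_add_sq_sub u v
    have hA := cubeMean_add u v
    have hB := cubeMean_sub u v
    have hp := ih fun x => u x + v x
    have hq := ih fun x => u x - v x
    change cubeEnergy h = cubeMean (fun x => (u x - v x) ^ 2) +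
      (cubeEnergy u + cubeEnergy v) / 2 at hE
    change cubeMean h = (cubeMean u + cubeMean v) / 2 at hM
    change _ = (cubeMean (fun x => u x ^ 2) + cubeMean (fun x => v x ^ 2)) / 2 at hM2
    rw [hA] at hp
    rw [hB] at hq
    have hq' : 0 ≤ cubeEnergy fun x => u x - v x := cubeEnergy_nonneg _
    rw [hE, hM, hM2]
    nlinarith

/-- A strengthened Poincaré inequality on the discrete cube, with an explicit account of the
first-level Fourier coefficients. -/
lemma two_mul_variance_le_cubeEnergy (h : (Fin n → Bool) → ℝ) :
    2 * (cubeMean (fun x => h x ^ 2) - cubeMean h ^ 2) ≤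
      cubeEnergy h / 4 + ∑ i, cubeMean (fun x => bitSign (x i) * h x) ^ 2 := by
  induction n with
  | zero => simp [cubeMean, cubeEnergy]
  | succ n ih =>
    set u : (Fin n → Bool) → ℝ := fun x => h (Fin.cons true x)
    set v : (Fin n → Bool) → ℝ := fun x => h (Fin.cons false x)
    have hE := cubeEnergy_succ h
    have hM := cubeMean_succ h
    have hM2 := cubeMean_succ fun x => h x ^ 2
    have hE2 := cubeEnergy_add_add_sub u v
    have hS := cubeMean_sq_add_sq_sub u v
    have hA := cubeMean_add u v
    have hB := cubeMean_sub u v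
    have hp := ih fun x => u x + v x
    have hq := cubeMean_sq_sub_sq_le_cubeEnergy fun x => u x - v x
    have hL : ∑ i, cubeMean (fun x => bitSign (x i) * h x) ^ 2 =
        ((cubeMean u - cubeMean v) / 2) ^ 2 +
          (∑ i, cubeMean (fun x => bitSign (x i) * (u x + v x)) ^ 2) / 4 := by
      rw [Fin.sum_univ_succ, Finset.sum_div]
      congr 1
      · rw [cubeMean_succ]
        simp only [Fin.cons_zero, bitSign, if_true, one_mul, Bool.false_eq_true, if_false,
          neg_mul, cubeMean_neg]
        rfl
      · refine Finset.sum_congr rfl fun i _ => ?_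
        rw [cubeMean_succ]
        simp only [Fin.cons_succ, mul_add, cubeMean_add]
        change ((cubeMean (fun x => bitSign (x i) * u x) +
          cubeMean (fun x => bitSign (x i) * v x)) / 2) ^ 2 = _
        ring
    change cubeEnergy h = cubeMean (fun x => (u x - v x) ^ 2) +
      (cubeEnergy u + cubeEnergy v) / 2 at hE
    change cubeMean h = (cubeMean u + cubeMean v) / 2 at hM
    change _ = (cubeMean (fun x => u x ^ 2) + cubeMean (fun x => v x ^ 2)) / 2 at hM2
    rw [hA] at hp
    rw [hB] at hq
    rw [hE, hM, hM2, hL]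
    nlinarith

end Poincare

section Khintchine

variable {n : ℕ}

lemma cubeMean_signSum_sq (a : Fin n → ℝ) :
    cubeMean (fun x => signSum a x ^ 2) = ∑ j, a j ^ 2 := by
  induction n with
  | zero => simp [cubeMean, signSum]
  | succ n ih =>
    have ht : ∀ b (x : Fin n → Bool), signSum a (Fin.cons b x) =
        a 0 * bitSign b + signSum (fun j => a j.succ) x := by
      intro b x
      simp [signSum, Fin.sum_univ_succ]
    rw [cubeMean_succ, Fin.sum_univ_succ, ← ih fun j => a j.succ, ← cubeMean_add]
    rw [← cubeMean_const (n := n) (a 0 ^ 2), ← cubeMean_add, div_eq_inv_mul, ← cubeMean_const_mul]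
    congr 1
    funext x
    simp only [ht, bitSign, if_true, Bool.false_eq_true, if_false]
    ring

lemma sub_two_mul_abs_signSum_le (a : Fin n → ℝ) (x : Fin n → Bool) :
    (n - 2) * |signSum a x| ≤ ∑ i, |signSum a (flipBit i x)| := by
  have h : ∑ i, signSum a (flipBit i x) = (n - 2) * signSum a x := by
    simp only [signSum_flipBit, Finset.sum_sub_distrib, ← Finset.mul_sum]
    simp [signSum]
    ring
  calc (n - 2) * |signSum a x| ≤ |(n : ℝ) - 2| * |signSum a x| := by
        gcongr
        exact le_abs_self _
    _ = |∑ i, signSum a (flipBit i x)| := by rw [h, abs_mul]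
    _ ≤ _ := Finset.abs_sum_le_sum_abs _ _

lemma cubeEnergy_eq (f : (Fin n → Bool) → ℝ) :
    cubeEnergy f = 2 * cubeMean fun x => f x * (n * f x - ∑ i, f (flipBit i x)) := by
  have h : ∀ x, f x * (n * f x - ∑ i, f (flipBit i x)) =
      ∑ i, (f x ^ 2 - f x * f (flipBit i x)) := by
    intro x
    rw [Finset.sum_sub_distrib, ← Finset.mul_sum]
    simp
    ring
  simp only [h, cubeMean_sum, Finset.mul_sum, cubeEnergy]
  refine Finset.sum_congr rfl fun i _ => ?_
  have h2 := cubeMean_comp_of_involutive (flipBit_involutive i) fun x => f x ^ 2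
  have h3 : (fun x => (f x - f (flipBit i x)) ^ 2) =
      fun x => 2 * (f x ^ 2 - f x * f (flipBit i x)) + (f (flipBit i x) ^ 2 - f x ^ 2) := by
    funext x
    ring
  rw [h3, cubeMean_add, cubeMean_sub _ (fun x => f x ^ 2), h2, cubeMean_const_mul, sub_self,
    add_zero]

/-- Khintchine's inequality with the optimal constant. -/
lemma sum_sq_le_two_mul_cubeMean_abs_signSum_sq (a : Fin n → ℝ) :
    ∑ j, a j ^ 2 ≤ 2 * cubeMean (fun x => |signSum a x|) ^ 2 := by
  have hP := two_mul_variance_le_cubeEnergy fun x => |signSum a x|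
  have h0 : ∀ i, cubeMean (fun x => bitSign (x i) * |signSum a x|) = 0 := by
    intro i
    have h := cubeMean_comp_of_involutive not_involutive
      fun x => bitSign (x i) * |signSum a x|
    simp only [signSum_not, bitSign_not, abs_neg, neg_mul, cubeMean_neg] at h
    linarith
  have hE : cubeEnergy (fun x => |signSum a x|) ≤ 4 * ∑ j, a j ^ 2 := by
    rw [cubeEnergy_eq, ← cubeMean_signSum_sq, ← cubeMean_const_mul, ← cubeMean_const_mul]
    refine cubeMean_mono fun x => ?_
    have h1 := sub_two_mul_abs_signSum_le a x
    nlinarith [abs_nonneg (signSum a x), sq_abs (signSum a x)]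
  simp only [h0, sq_abs, cubeMean_signSum_sq] at hP
  simp at hP
  linarith

lemma inv_two_mul_sqrt_two_le_cubeMean_abs (a : Fin n → ℝ) (ha : ∑ j, a j ^ 2 = 1) :
    1 / (2 * √2) ≤ cubeMean fun x => |∑ j, a j * bitVec x j| := by
  have hK := sum_sq_le_two_mul_cubeMean_abs_signSum_sq a
  have hs : cubeMean (fun x => |signSum a x|) ≤
      2 * cubeMean fun x => |∑ j, a j * bitVec x j| := by
    have h := cubeMean_comp_of_involutive not_involutive fun x => |∑ j, a j * bitVec x j|
    rw [two_mul]
    nth_rewrite 1 [← h]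
    rw [← cubeMean_add]
    refine cubeMean_mono fun x => ?_
    have hx : signSum a x = ∑ j, a j * bitVec x j - ∑ j, a j * bitVec (fun j => !x j) j := by
      rw [← Finset.sum_sub_distrib]
      refine Finset.sum_congr rfl fun j _ => ?_
      cases hj : x j <;> simp [bitVec, bitSign, hj]
    rw [hx, add_comm]
    exact abs_sub _ _
  have hm : 0 ≤ cubeMean fun x => |signSum a x| := by
    rw [← cubeMean_const (n := n) 0]
    exact cubeMean_mono fun x => abs_nonneg _
  have h2 : 1 / √2 ≤ cubeMean fun x => |signSum a x| := by
    refine (sq_le_sq₀ (by positivity) hm).1 ?_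
    rw [div_pow, Real.sq_sqrt (by norm_num)]
    linarith
  have h3 : 1 / (2 * √2) = 1 / √2 / 2 := by ring
  linarith

end Khintchine

section InfConvolution

variable {n : ℕ}

/-- The infimal convolution of `F` with half the squared Euclidean norm. -/
noncomputable def infConv (F : (Fin n → ℝ) → ℝ) (x : Fin n → ℝ) : ℝ :=
  ⨅ y, F y + (∑ j, (x j - y j) ^ 2) / 2

lemma infConv_le {F : (Fin n → ℝ) → ℝ} (hF : ∀ y, 0 ≤ F y) (x y : Fin n → ℝ) :
    infConv F x ≤ F y + (∑ j, (x j - y j) ^ 2) / 2 := by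
  refine ciInf_le ⟨0, ?_⟩ y
  rintro _ ⟨z, rfl⟩
  have := hF z
  positivity

lemma cons_combo (a b s r : ℝ) (y z : Fin n → ℝ) :
    (Fin.cons (a • s + b • r) (a • y + b • z) : Fin (n + 1) → ℝ) =
      a • (Fin.cons s y : Fin (n + 1) → ℝ) + b • (Fin.cons r z : Fin (n + 1) → ℝ) := by
  funext j
  refine Fin.cases ?_ (fun i => ?_) j <;> simp

lemma convexOn_infConv_cons {F : (Fin (n + 1) → ℝ) → ℝ} (hF : ∀ y, 0 ≤ F y)
    (hc : ConvexOn ℝ Set.univ F) (x : Fin n → ℝ) :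
    ConvexOn ℝ Set.univ fun s : ℝ => infConv (fun y => F (Fin.cons s y)) x := by
  refine ⟨convex_univ, fun s _ r _ a b ha hb hab => ?_⟩
  refine le_of_forall_pos_le_add fun ε hε => ?_
  obtain ⟨y, hy⟩ := exists_lt_of_ciInf_lt
    (lt_add_of_pos_right (infConv (fun y => F (Fin.cons s y)) x) hε)
  obtain ⟨z, hz⟩ := exists_lt_of_ciInf_lt
    (lt_add_of_pos_right (infConv (fun y => F (Fin.cons r y)) x) hε)
  have h1 := infConv_le (F := fun y => F (Fin.cons (a • s + b • r) y)) (fun _ => hF _) x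
    (a • y + b • z)
  have h2 := hc.2 (Set.mem_univ (Fin.cons s y : Fin (n + 1) → ℝ))
    (Set.mem_univ (Fin.cons r z : Fin (n + 1) → ℝ)) ha hb hab
  rw [← cons_combo] at h2
  have h3 : ∑ j, (x j - (a • y + b • z) j) ^ 2 ≤
      a * ∑ j, (x j - y j) ^ 2 + b * ∑ j, (x j - z j) ^ 2 := by
    rw [Finset.mul_sum, Finset.mul_sum, ← Finset.sum_add_distrib]
    refine Finset.sum_le_sum fun j _ => ?_
    have := (even_two.convexOn_pow (𝕜 := ℝ)).2 (Set.mem_univ (x j - y j))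
      (Set.mem_univ (x j - z j)) ha hb hab
    simp only [smul_eq_mul] at this
    convert this using 2
    simp only [Pi.add_apply, Pi.smul_apply, smul_eq_mul]
    linear_combination (-x j) * hab
  have h4 := mul_le_mul_of_nonneg_left hy.le ha
  have h5 := mul_le_mul_of_nonneg_left hz.le hb
  simp only [smul_eq_mul] at h1 h2 ⊢
  have h6 : a * ε + b * ε = ε := by rw [← add_mul, hab, one_mul]
  linarith

lemma one_add_exp_neg_le (b : ℝ) : 1 + Real.exp (-b) ≤ 2 * Real.exp (-b / 2 + b ^ 2 / 4) := by
  have h := Real.cosh_le_exp_half_sq (b / 2)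
  have h1 : 1 + Real.exp (-b) = 2 * (Real.exp (-b / 2) * Real.cosh (b / 2)) := by
    rw [Real.cosh_eq, mul_div_assoc', mul_add, ← Real.exp_add, ← Real.exp_add]
    ring_nf
    simp [add_comm]
  rw [h1, Real.exp_add]
  gcongr
  refine h.trans (Real.exp_le_exp.2 ?_)
  nlinarith [sq_nonneg b]

/-- The ordered two-point case of the exponential infimum-convolution inequality. -/
lemma two_point_of_le {G : ℝ → ℝ} (hc : ConvexOn ℝ Set.univ G) {p q k l : ℝ}
    (hle : G p ≤ G q) (hpq : (q - p) ^ 2 = 1)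
    (hk : ∀ r, k ≤ G r + (p - r) ^ 2 / 2) (hl : ∀ r, l ≤ G r + (q - r) ^ 2 / 2) :
    (Real.exp (-G p) + Real.exp (-G q)) / 2 ≤ Real.exp (-((k + l) / 2)) := by
  set b := G q - G p with hb
  have hk' : k ≤ G p := by simpa using hk p
  have hexp : Real.exp (-G p) + Real.exp (-G q) = Real.exp (-G p) * (1 + Real.exp (-b)) := by
    rw [mul_add, mul_one, ← Real.exp_add]
    congr 2
    rw [hb]
    ring
  have key : ∀ c, c ≤ b → l ≤ G p + c - c ^ 2 / 2 → (Real.exp (-G p) + Real.exp (-G q)) / 2 ≤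
      Real.exp (-((k + l) / 2)) := by
    intro c hcb hlc
    have h1 : 1 + Real.exp (-b) ≤ 2 * Real.exp (-c / 2 + c ^ 2 / 4) :=
      le_trans (by gcongr) (one_add_exp_neg_le c)
    rw [hexp]
    calc Real.exp (-G p) * (1 + Real.exp (-b)) / 2
        ≤ Real.exp (-G p) * (2 * Real.exp (-c / 2 + c ^ 2 / 4)) / 2 := by gcongr
      _ = Real.exp (-G p + (-c / 2 + c ^ 2 / 4)) := by rw [Real.exp_add (-G p)]; ring
      _ ≤ _ := Real.exp_le_exp.2 (by linarith)
  by_cases h1 : b ≤ 1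
  · refine key b le_rfl ?_
    have h2 := hc.2 (Set.mem_univ p) (Set.mem_univ q) (sub_nonneg.2 hle) (sub_nonneg.2 h1)
      (by rw [hb]; ring)
    have h3 := hl (b * p + (1 - b) * q)
    simp only [smul_eq_mul] at h2
    rw [← hb] at h2
    have h4 : (q - (b * p + (1 - b) * q)) ^ 2 = b ^ 2 := by linear_combination b ^ 2 * hpq
    rw [h4] at h3
    have h5 : G q = G p + b := by rw [hb]; ring
    rw [h5] at h2
    nlinarith
  · refine key 1 (not_le.1 h1).le ?_
    have := hl p
    rw [hpq] at this
    linarith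

lemma two_point {G : ℝ → ℝ} (hc : ConvexOn ℝ Set.univ G) {k l : ℝ}
    (hk : ∀ r, k ≤ G r + (1 - r) ^ 2 / 2) (hl : ∀ r, l ≤ G r + (0 - r) ^ 2 / 2) :
    (Real.exp (-G 1) + Real.exp (-G 0)) / 2 ≤ Real.exp (-((k + l) / 2)) := by
  rcases le_total (G 1) (G 0) with h | h
  · exact two_point_of_le hc h (by norm_num) hk hl
  · rw [add_comm, add_comm k]
    exact two_point_of_le hc h (by norm_num) hl hk

lemma bitVec_cons (b : Bool) (x : Fin n → Bool) :
    bitVec (Fin.cons b x : Fin (n + 1) → Bool) = Fin.cons (if b then 1 else 0) (bitVec x) := by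
  funext j
  refine Fin.cases ?_ (fun i => ?_) j <;> simp [bitVec]

/-- The exponential infimum-convolution inequality for convex functions on the cube. -/
lemma cubeMean_exp_neg_le (F : (Fin n → ℝ) → ℝ) (hF : ∀ y, 0 ≤ F y)
    (hc : ConvexOn ℝ Set.univ F) :
    cubeMean (fun x => Real.exp (-F (bitVec x))) ≤
      Real.exp (-cubeMean fun x => infConv F (bitVec x)) := by
  induction n with
  | zero =>
    simp only [cubeMean, pow_zero, div_one, Finset.univ_unique, Finset.sum_singleton]
    refine Real.exp_le_exp.2 (neg_le_neg ((infConv_le hF _ (bitVec default)).trans_eq ?_))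
    simp only [Finset.univ_eq_empty, Finset.sum_empty, zero_div, add_zero]
    congr 2
    exact Subsingleton.elim _ _
  | succ n ih =>
    set G : ℝ → ℝ := fun s =>
      cubeMean fun x : Fin n → Bool => infConv (fun y => F (Fin.cons s y)) (bitVec x) with hG
    have hGc : ConvexOn ℝ Set.univ G := by
      refine ⟨convex_univ, fun s _ r _ a b ha hb hab => ?_⟩
      simp only [hG, smul_eq_mul]
      rw [← cubeMean_const_mul, ← cubeMean_const_mul, ← cubeMean_add]
      exact cubeMean_mono fun x => (convexOn_infConv_cons hF hc (bitVec x)).2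
        (Set.mem_univ s) (Set.mem_univ r) ha hb hab
    have hslice : ∀ s, cubeMean (fun x : Fin n → Bool => Real.exp (-F (Fin.cons s (bitVec x)))) ≤
        Real.exp (-G s) := by
      intro s
      refine ih (fun y => F (Fin.cons s y)) (fun _ => hF _)
        ⟨convex_univ, fun y _ z _ a b ha hb hab => ?_⟩
      have h := cons_combo a b s s y z
      rw [← add_smul, hab, one_smul] at h
      simp only [h]
      exact hc.2 (Set.mem_univ _) (Set.mem_univ _) ha hb hab
    have hQ : ∀ s r, cubeMean (fun x : Fin n → Bool => infConv F (Fin.cons s (bitVec x))) ≤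
        G r + (s - r) ^ 2 / 2 := by
      intro s r
      rw [← cubeMean_const (n := n) ((s - r) ^ 2 / 2), hG, ← cubeMean_add]
      refine cubeMean_mono fun x => ?_
      rw [← sub_le_iff_le_add]
      refine le_ciInf fun y => ?_
      have h := infConv_le hF (Fin.cons s (bitVec x)) (Fin.cons r y)
      simp only [Fin.sum_univ_succ, Fin.cons_zero, Fin.cons_succ] at h
      linarith
    rw [cubeMean_succ, cubeMean_succ]
    simp only [bitVec_cons, if_true, Bool.false_eq_true, if_false]
    refine le_trans ?_ (two_point hGc (hQ 1) (hQ 0))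
    linarith [hslice 1, hslice 0]

end InfConvolution

section Rotation

variable {d : ℕ}

lemma sum_mulVec_sq {O : Matrix (Fin d) (Fin d) ℝ} (hO : IsOrthogonalMat O) (v : Fin d → ℝ) :
    ∑ i, (O.mulVec v) i ^ 2 = ∑ j, v j ^ 2 := by
  have h : O.mulVec v ⬝ᵥ O.mulVec v = v ⬝ᵥ v := by
    rw [Matrix.dotProduct_mulVec, ← Matrix.mulVec_transpose, Matrix.mulVec_mulVec, hO.1,
      Matrix.one_mulVec]
  simpa [dotProduct, sq] using h

lemma row_sq_sum {O : Matrix (Fin d) (Fin d) ℝ} (hO : IsOrthogonalMat O) (i : Fin d) :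
    ∑ j, O i j ^ 2 = 1 := by
  have h := congrFun (congrFun hO.2 i) i
  simpa [Matrix.mul_apply, sq] using h

lemma convexOn_l1Norm_mulVec (O : Matrix (Fin d) (Fin d) ℝ) {t : ℝ} (ht : 0 ≤ t) :
    ConvexOn ℝ Set.univ fun v => t * l1Norm (O.mulVec v) := by
  refine ⟨convex_univ, fun y _ z _ a b ha hb _ => ?_⟩
  have h : l1Norm (O.mulVec (a • y + b • z)) ≤
      a * l1Norm (O.mulVec y) + b * l1Norm (O.mulVec z) := by
    unfold l1Norm
    rw [Finset.mul_sum, Finset.mul_sum, ← Finset.sum_add_distrib]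
    refine Finset.sum_le_sum fun i _ => ?_
    rw [Matrix.mulVec_add, Matrix.mulVec_smul, Matrix.mulVec_smul]
    refine (abs_add_le _ _).trans_eq ?_
    simp [abs_mul, abs_of_nonneg ha, abs_of_nonneg hb]
  simp only [smul_eq_mul]
  nlinarith [mul_le_mul_of_nonneg_left h ht]

lemma sub_le_infConv_l1Norm {O : Matrix (Fin d) (Fin d) ℝ} (hO : IsOrthogonalMat O) {t : ℝ}
    (ht : 0 ≤ t) (x : Fin d → ℝ) :
    t * l1Norm (O.mulVec x) - t ^ 2 * d / 2 ≤ infConv (fun v => t * l1Norm (O.mulVec v)) x := by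
  refine le_ciInf fun y => ?_
  have h := sum_mulVec_sq hO (x - y)
  simp only [Pi.sub_apply] at h
  have hd : t ^ 2 * d / 2 = ∑ _i : Fin d, t ^ 2 / 2 := by simp; ring
  simp only [l1Norm]
  rw [← h, hd, Finset.mul_sum, Finset.mul_sum, Finset.sum_div,
    ← Finset.sum_sub_distrib, ← Finset.sum_add_distrib]
  refine Finset.sum_le_sum fun i _ => ?_
  rw [Matrix.mulVec_sub, Pi.sub_apply]
  have h1 := abs_sub_abs_le_abs_sub ((O.mulVec x) i) ((O.mulVec y) i)
  have h2 := mul_le_mul_of_nonneg_left h1 ht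
  nlinarith [sq_nonneg (|(O.mulVec x) i - (O.mulVec y) i| - t),
    sq_abs ((O.mulVec x) i - (O.mulVec y) i)]

lemma le_cubeMean_l1Norm {O : Matrix (Fin d) (Fin d) ℝ} (hO : IsOrthogonalMat O) :
    d * (1 / (2 * √2)) ≤ cubeMean fun x => l1Norm (O.mulVec (bitVec x)) := by
  simp only [l1Norm, cubeMean_sum]
  have h := Finset.card_nsmul_le_sum (Finset.univ : Finset (Fin d))
    (fun i => cubeMean fun x => |(O.mulVec (bitVec x)) i|) (1 / (2 * √2))
    fun i _ => inv_two_mul_sqrt_two_le_cubeMean_abs (O i) (row_sq_sum hO i)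
  simpa using h

/-- The lower-tail subgaussian bound for the `ℓ₁`-norm of a rotated cube vertex. -/
lemma cubeMean_exp_neg_l1Norm_le {O : Matrix (Fin d) (Fin d) ℝ} (hO : IsOrthogonalMat O) {t : ℝ}
    (ht : 0 ≤ t) :
    cubeMean (fun x => Real.exp (-(t * l1Norm (O.mulVec (bitVec x))))) ≤
      Real.exp (-(t * (d * (1 / (2 * √2)))) + t ^ 2 * d / 2) := by
  refine (cubeMean_exp_neg_le (fun v => t * l1Norm (O.mulVec v))
    (fun y => mul_nonneg ht (Finset.sum_nonneg fun _ _ => abs_nonneg _))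
    (convexOn_l1Norm_mulVec O ht)).trans (Real.exp_le_exp.2 ?_)
  have h := cubeMean_mono fun x : Fin d → Bool => sub_le_infConv_l1Norm hO ht (bitVec x)
  rw [cubeMean_sub, cubeMean_const, cubeMean_const_mul] at h
  linarith [mul_le_mul_of_nonneg_left (le_cubeMean_l1Norm hO) ht]

end Rotation

end RotatedCube

/-- concentration bound for the `ℓ₁`-norm of vertices of the rotated
Hamming cube: the number of `x ∈ {0,1}^d` with `‖Ox‖₁ ≤ d/4` is at most
`2^d·exp(−(d/2)·(1/(2√2) − 1/4)²)`. -/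
theorem l1_norm_rotated_cube_concentration (d : ℕ) (hd : 1 ≤ d)
    (O : Matrix (Fin d) (Fin d) ℝ) (hO : IsOrthogonalMat O) :
    (((Finset.univ : Finset (Fin d → Bool)).filter fun x =>
        l1Norm (O.mulVec (bitVec x)) ≤ (d : ℝ) / 4).card : ℝ)
      ≤ 2 ^ d * Real.exp (-((d : ℝ) / 2) * (1 / (2 * Real.sqrt 2) - 1 / 4) ^ 2) := by
  set c : ℝ := 1 / (2 * √2) - 1 / 4 with hc
  have hc0 : 0 ≤ c := by
    have h2 : √2 ≤ 2 := by
      rw [Real.sqrt_le_left (by norm_num)]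
      norm_num
    have h4 : (1 : ℝ) / 4 ≤ 1 / (2 * √2) :=
      one_div_le_one_div_of_le (by positivity) (by linarith)
    rw [hc]
    linarith
  set S := (Finset.univ : Finset (Fin d → Bool)).filter fun x =>
    l1Norm (O.mulVec (bitVec x)) ≤ (d : ℝ) / 4 with hS
  have hmgf := RotatedCube.cubeMean_exp_neg_l1Norm_le hO hc0
  rw [RotatedCube.cubeMean, div_le_iff₀ (by positivity)] at hmgf
  have hmarkov : (S.card : ℝ) * Real.exp (-(c * (d / 4))) ≤
      ∑ x : Fin d → Bool, Real.exp (-(c * l1Norm (O.mulVec (bitVec x)))) := by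
    rw [← nsmul_eq_mul]
    refine (Finset.card_nsmul_le_sum S _ _ fun x hx => ?_).trans
      (Finset.sum_le_sum_of_subset_of_nonneg (Finset.subset_univ S) fun _ _ _ =>
        (Real.exp_pos _).le)
    have hx' := (Finset.mem_filter.1 hx).2
    gcongr
  rw [← mul_le_mul_iff_of_pos_right (Real.exp_pos (-(c * (d / 4)))), mul_assoc, ← Real.exp_add]
  refine (hmarkov.trans hmgf).trans_eq ?_
  rw [mul_comm]
  congr 2
  have h1 : 1 / (2 * √2) = c + 1 / 4 := by rw [hc]; ring
  rw [h1]
  ring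
end
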